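/- arXiv:math/0203249 — 3 statements merged into one kernel-verified Lean document; each statement's English description precedes it below -/
import Mathlib

section
/- Let ρ : A → P be a basic scaling and n ≥ 1. If x₁, …, xₙ ∈ A are pairwise disjoint (xᵢ ∧ xⱼ = 0 for i ≠ j), y₁, …, yₙ ∈ A are pairwise disjoint, and ρ(xᵢ) = ρ(yᵢ) for every i, then ρ(x₁ ∨ ⋯ ∨ xₙ) = ρ(y₁ ∨ ⋯ ∨ yₙ). (Hence the n-fold sum ρ(x₁) + ⋯ + ρ(xₙ) of images of pairwise disjoint elements is unambiguously defined.) -/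
/-- A *basic scaling* is a strictly increasing map from a Boolean algebra to a
partially ordered set that preserves relative complementation. -/
structure IsBasicScaling {A P : Type*} [BooleanAlgebra A] [PartialOrder P]
    (ρ : A → P) : Prop where
  mono : ∀ x y : A, x < y → ρ x < ρ y
  relcomp_lt : ∀ a b x y : A, a ≤ x → x ≤ b → a ≤ y → y ≤ b →
      ρ x < ρ y → ρ (a ⊔ (b ⊓ yᶜ)) < ρ (a ⊔ (b ⊓ xᶜ))
  relcomp_eq : ∀ a b x y : A, a ≤ x → x ≤ b → a ≤ y → y ≤ b →
      ρ x = ρ y → ρ (a ⊔ (b ⊓ xᶜ)) = ρ (a ⊔ (b ⊓ yᶜ))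

/-- A basic scaling is *divided* if whenever `ρ x < ρ y` there is `y₁ < y`
with `ρ y₁ = ρ x`. -/
def Divided {A P : Type*} [BooleanAlgebra A] [PartialOrder P] (ρ : A → P) : Prop :=
  ∀ x y : A, ρ x < ρ y → ∃ y₁, y₁ < y ∧ ρ y₁ = ρ x

namespace IsBasicScaling

variable {A P : Type*} [BooleanAlgebra A] [PartialOrder P] {ρ : A → P}

theorem sup_right_congr (h : IsBasicScaling ρ) {x y z : A} (hx : Disjoint x z)
    (hy : Disjoint y z) (hxy : ρ x = ρ y) : ρ (x ⊔ z) = ρ (y ⊔ z) := by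
  have hc := h.relcomp_eq ⊥ zᶜ x y bot_le hx.le_compl_right bot_le hy.le_compl_right hxy
  have hcc := h.relcomp_eq ⊥ ⊤ _ _ bot_le le_top bot_le le_top hc
  simpa [compl_inf, sup_comm] using hcc

theorem sup_congr (h : IsBasicScaling ρ) {x₁ x₂ y₁ y₂ : A} (hx : Disjoint x₁ x₂)
    (hy : Disjoint y₁ y₂) (h₁ : ρ x₁ = ρ y₁) (h₂ : ρ x₂ = ρ y₂) :
    ρ (x₁ ⊔ x₂) = ρ (y₁ ⊔ y₂) := by
  have hx' : ρ (x₁ ⊔ x₂ \ y₁) = ρ (y₁ ⊔ x₂ \ y₁) :=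
    h.sup_right_congr (hx.mono_right sdiff_le) disjoint_sdiff_self_right h₁
  have hy' : ρ (x₂ ⊔ y₁ \ x₂) = ρ (y₂ ⊔ y₁ \ x₂) :=
    h.sup_right_congr disjoint_sdiff_self_right (hy.symm.mono_right sdiff_le) h₂
  have hmid : ρ (x₁ ⊔ x₂ \ y₁) = ρ (y₂ ⊔ y₁ \ x₂) := by
    rw [hx', ← hy', sup_sdiff_self_right, sup_sdiff_self_right, sup_comm]
  have hadd := h.sup_right_congr (z := x₂ ⊓ y₁)
    (Disjoint.sup_left (hx.mono_right inf_le_left) (disjoint_sdiff_self_left.mono_right inf_le_right))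
    (Disjoint.sup_left (hy.symm.mono_right inf_le_right)
      (disjoint_sdiff_self_left.mono_right inf_le_left)) hmid
  rwa [sup_assoc, sup_assoc, sup_comm (x₂ \ y₁), sup_inf_sdiff, inf_comm,
    sup_comm (y₁ \ x₂), sup_inf_sdiff, sup_comm y₂] at hadd

theorem finset_sup_congr (h : IsBasicScaling ρ) {ι : Type*} (s : Finset ι) {x y : ι → A}
    (hx : Pairwise (Function.onFun Disjoint x)) (hy : Pairwise (Function.onFun Disjoint y))
    (hxy : ∀ i, ρ (x i) = ρ (y i)) : ρ (s.sup x) = ρ (s.sup y) := by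
  induction s using Finset.cons_induction with
  | empty => rfl
  | cons i s hi ih =>
    rw [Finset.sup_cons, Finset.sup_cons]
    have hne : ∀ j ∈ s, i ≠ j := fun j hj hij => hi (hij ▸ hj)
    exact h.sup_congr (Finset.disjoint_sup_right.2 fun j hj => hx (hne j hj))
      (Finset.disjoint_sup_right.2 fun j hj => hy (hne j hj)) (hxy i) ih

end IsBasicScaling

theorem stmt_4 {A P : Type*} [BooleanAlgebra A] [PartialOrder P] (ρ : A → P)
    (h : IsBasicScaling ρ) (n : ℕ) (hn : 1 ≤ n) (x y : Fin n → A)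
    (hx : ∀ i j, i ≠ j → x i ⊓ x j = ⊥)
    (hy : ∀ i j, i ≠ j → y i ⊓ y j = ⊥)
    (hxy : ∀ i, ρ (x i) = ρ (y i)) :
    ρ (Finset.univ.sup x) = ρ (Finset.univ.sup y) := by
  exact h.finset_sup_congr _ (fun i j hij => disjoint_iff.2 (hx i j hij))
    (fun i j hij => disjoint_iff.2 (hy i j hij)) hxy
end

section
/- (Relative complement well-definedness) Let ρ : A → P be a basic scaling. If a ≤ x ≤ b, c ≤ y ≤ d, ρ(a) = ρ(c), ρ(x) = ρ(y), and ρ(b) = ρ(d), then ρ(a ∨ (b ∧ xᶜ)) = ρ(c ∨ (d ∧ yᶜ)). In other words, the image under ρ of the complement of x relative to [a,b] depends on x, a, b only through ρ(x), ρ(a), ρ(b). -/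
namespace IsBasicScaling

variable {A P : Type*} [BooleanAlgebra A] [PartialOrder P] {ρ : A → P}

theorem map_compl_eq (h : IsBasicScaling ρ) {x y : A} (hxy : ρ x = ρ y) : ρ xᶜ = ρ yᶜ := by
  simpa using h.relcomp_eq ⊥ ⊤ x y bot_le le_top bot_le le_top hxy

theorem map_sup_right_eq (h : IsBasicScaling ρ) {x y t : A} (hx : Disjoint x t)
    (hy : Disjoint y t) (hxy : ρ x = ρ y) : ρ (x ⊔ t) = ρ (y ⊔ t) := by
  simpa [sup_comm] using h.relcomp_eq t ⊤ xᶜ yᶜ hx.le_compl_left le_top hy.le_compl_left le_top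
    (h.map_compl_eq hxy)

/-- The value of a basic scaling on a disjoint join depends only on its values on the two parts. -/
theorem map_sup_eq (h : IsBasicScaling ρ) {x x' y y' : A} (hx : Disjoint x x')
    (hy : Disjoint y y') (hxy : ρ x = ρ y) (hxy' : ρ x' = ρ y') :
    ρ (x ⊔ x') = ρ (y ⊔ y') := by
  have h₁ : ρ (x ⊔ x' \ y) = ρ (y ⊔ x' \ y) :=
    h.map_sup_right_eq (hx.mono_right sdiff_le) disjoint_sdiff_self_right hxy
  have h₂ : ρ (x' ⊔ y \ x') = ρ (y' ⊔ y \ x') :=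
    h.map_sup_right_eq disjoint_sdiff_self_right (hy.symm.mono_right sdiff_le) hxy'
  have h₃ : ρ (x ⊔ x' \ y) = ρ (y' ⊔ y \ x') := by
    rw [h₁, ← h₂, sup_sdiff_self_right, sup_sdiff_self_right, sup_comm]
  have h₄ := h.map_sup_right_eq (t := x' ⊓ y)
    ((hx.mono_right inf_le_left).sup_left (disjoint_sdiff_self_left.mono_right inf_le_right))
    ((hy.symm.mono_right inf_le_right).sup_left
      (disjoint_sdiff_self_left.mono_right inf_le_left)) h₃
  rw [sup_assoc, sup_assoc, sup_comm (x' \ y), sup_inf_sdiff, inf_comm, sup_comm (y \ x'),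
    sup_inf_sdiff, sup_comm y'] at h₄
  exact h₄

theorem map_sdiff_eq (h : IsBasicScaling ρ) {x y b d : A} (hxb : x ≤ b) (hyd : y ≤ d)
    (hxy : ρ x = ρ y) (hbd : ρ b = ρ d) : ρ (b ⊓ xᶜ) = ρ (d ⊓ yᶜ) := by
  have := h.map_compl_eq (h.map_sup_eq (disjoint_compl_right.mono_left hxb)
    (disjoint_compl_right.mono_left hyd) hxy (h.map_compl_eq hbd))
  simpa [inf_comm] using this

end IsBasicScaling

theorem stmt_7 {A P : Type*} [BooleanAlgebra A] [PartialOrder P] (ρ : A → P)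
    (h : IsBasicScaling ρ) (a b c d x y : A)
    (hax : a ≤ x) (hxb : x ≤ b) (hcy : c ≤ y) (hyd : y ≤ d)
    (hac : ρ a = ρ c) (hxy : ρ x = ρ y) (hbd : ρ b = ρ d) :
    ρ (a ⊔ (b ⊓ xᶜ)) = ρ (c ⊔ (d ⊓ yᶜ)) := by
  exact h.map_sup_eq (disjoint_compl_right.mono hax inf_le_right)
    (disjoint_compl_right.mono hcy inf_le_right) hac (h.map_sdiff_eq hxb hyd hxy hbd)
end

section
/- (Divided implies measurable, finite case) Let S be a finite set, A the Boolean algebra of all subsets of S, and ρ : A → P a divided basic scaling. Then there exists m : A → ℝ such that: m(T) > 0 for every nonempty T ⊆ S; m(T₁ ∪ T₂) = m(T₁) + m(T₂) whenever T₁ ∩ T₂ = ∅; m(T₁) = m(T₂) whenever ρ(T₁) = ρ(T₂); and m(T₁) < m(T₂) whenever ρ(T₁) < ρ(T₂). (That is, m factors as a strictly increasing measure on the scale that is the image of ρ.) -/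
namespace IsBasicScaling

variable {S P : Type*} [PartialOrder P] {ρ : Set S → P}

/-- A common part of two sets of equal scale can be cancelled. -/
theorem diff_eq_diff (h : IsBasicScaling ρ) {x y : Set S} (hxy : ρ x = ρ y) :
    ρ (x \ y) = ρ (y \ x) := by
  have key := h.relcomp_eq ∅ (x ∪ y) x y (Set.empty_subset _) Set.subset_union_left
    (Set.empty_subset _) Set.subset_union_right hxy
  have hx : (∅ ⊔ (x ∪ y) ⊓ xᶜ : Set S) = y \ x := by ext; simp; tauto
  have hy : (∅ ⊔ (x ∪ y) ⊓ yᶜ : Set S) = x \ y := by ext; simp; tauto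
  rw [hx, hy] at key
  exact key.symm

/-- A set disjoint from two disjoint sets of equal scale can be added to both. -/
theorem union_eq_union (h : IsBasicScaling ρ) {x y z : Set S} (hd : Disjoint x y)
    (hxz : Disjoint x z) (hyz : Disjoint y z) (hxy : ρ x = ρ y) :
    ρ (x ∪ z) = ρ (y ∪ z) := by
  have key := h.relcomp_eq ∅ (x ∪ y ∪ z) x y (Set.empty_subset _)
    (Set.subset_union_left.trans Set.subset_union_left) (Set.empty_subset _)
    (Set.subset_union_right.trans Set.subset_union_left) hxy
  rw [Set.disjoint_left] at hd hxz hyz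
  have hx : (∅ ⊔ (x ∪ y ∪ z) ⊓ xᶜ : Set S) = y ∪ z := by
    ext a; have := @hd a; have := @hxz a; simp; tauto
  have hy : (∅ ⊔ (x ∪ y ∪ z) ⊓ yᶜ : Set S) = x ∪ z := by
    ext a; have := @hd a; have := @hyz a; simp; tauto
  rw [hx, hy] at key
  exact key.symm

theorem empty_lt (h : IsBasicScaling ρ) {x : Set S} (hx : x.Nonempty) : ρ ∅ < ρ x :=
  h.mono _ _ (Set.empty_ssubset.2 hx)

/-- For a divided scaling, a set of the same scale as a singleton is a singleton. -/
theorem exists_eq_singleton (h : IsBasicScaling ρ) (hdiv : Divided ρ) {s : S} {y : Set S}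
    (hy : ρ y = ρ {s}) : ∃ t, y = {t} := by
  have hs : ρ ∅ < ρ {s} := h.empty_lt (Set.singleton_nonempty s)
  obtain rfl | ⟨t, ht⟩ := y.eq_empty_or_nonempty
  · exact absurd hy hs.ne
  refine ⟨t, ?_⟩
  by_contra hne
  have hlt : ρ {t} < ρ y :=
    h.mono _ _ ((Set.singleton_subset_iff.2 ht).lt_of_ne (Ne.symm hne))
  obtain ⟨z, hz, hzt⟩ := hdiv _ _ (hy ▸ hlt)
  obtain rfl : z = ∅ := Set.ssubset_singleton_iff.1 hz
  exact (h.empty_lt (Set.singleton_nonempty t)).ne hzt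

/-- For a divided scaling, if `x` and `y` have the same scale then every `s ∈ x` has the same
scale as some `t ∈ y`. -/
theorem exists_mem_singleton_eq (h : IsBasicScaling ρ) (hdiv : Divided ρ) {x y : Set S}
    (hxy : ρ x = ρ y) {s : S} (hs : s ∈ x) : ∃ t ∈ y, ρ {s} = ρ {t} := by
  obtain ⟨z, hzy, hz⟩ : ∃ z ⊆ y, ρ z = ρ {s} := by
    by_cases hx : {s} = x
    · exact ⟨y, subset_rfl, by rw [hx, hxy]⟩
    · have hlt : ρ {s} < ρ x := h.mono _ _ ((Set.singleton_subset_iff.2 hs).lt_of_ne hx)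
      obtain ⟨z, hz, hzs⟩ := hdiv _ _ (hxy ▸ hlt)
      exact ⟨z, hz.le, hzs⟩
  obtain ⟨t, rfl⟩ := h.exists_eq_singleton hdiv hz
  exact ⟨t, hzy rfl, hz.symm⟩

theorem ncard_eq_of_disjoint [Finite S] (h : IsBasicScaling ρ) (hdiv : Divided ρ) (n : ℕ) :
    ∀ x y : Set S, x.ncard = n → Disjoint x y → ρ x = ρ y → y.ncard = n := by
  induction n with
  | zero =>
    intro x y hx _ hxy
    rw [Set.ncard_eq_zero] at hx ⊢
    subst hx
    by_contra hy
    exact (h.empty_lt (Set.nonempty_iff_ne_empty.2 hy)).ne hxy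
  | succ n ih =>
    intro x y hx hd hxy
    obtain ⟨s, hs⟩ : x.Nonempty := by
      rw [← Set.ncard_pos, hx]; exact n.succ_pos
    obtain ⟨t, ht, hst⟩ := h.exists_mem_singleton_eq hdiv hxy hs
    have hdl := Set.disjoint_left.1 hd
    have hsum : ρ ({s} ∪ x \ {s}) = ρ ({t} ∪ x \ {s}) :=
      h.union_eq_union (Set.disjoint_singleton.2 fun e => hdl hs (e ▸ ht))
        Set.disjoint_sdiff_right
        (Set.disjoint_singleton_left.2 fun e => hdl e.1 ht) hst
    rw [Set.union_sdiff_cancel (Set.singleton_subset_iff.2 hs), hxy] at hsum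
    have hdiff := h.diff_eq_diff hsum.symm
    have hx' : ({t} ∪ x \ {s}) \ y = x \ {s} := by
      ext a; have := @hdl a; simp only [Set.mem_sdiff, Set.mem_union, Set.mem_singleton_iff]; grind
    have hy' : y \ ({t} ∪ x \ {s}) = y \ {t} := by
      ext a; have := @hdl a; simp only [Set.mem_sdiff, Set.mem_union, Set.mem_singleton_iff]; grind
    rw [hx', hy'] at hdiff
    have hcard := ih (x \ {s}) (y \ {t}) (by rw [Set.ncard_sdiff_singleton_of_mem hs, hx]; rfl)
      (hd.mono Set.sdiff_subset Set.sdiff_subset) hdiff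
    rw [← Set.ncard_sdiff_singleton_add_one ht, hcard]

/-- For a divided scaling on a finite power set, sets of equal scale are equinumerous. -/
theorem ncard_eq [Finite S] (h : IsBasicScaling ρ) (hdiv : Divided ρ) {x y : Set S}
    (hxy : ρ x = ρ y) : x.ncard = y.ncard := by
  have hcard := h.ncard_eq_of_disjoint hdiv _ (x \ y) (y \ x) rfl disjoint_sdiff_sdiff
    (h.diff_eq_diff hxy)
  rw [← Set.ncard_inter_add_ncard_sdiff_eq_ncard x y,
    ← Set.ncard_inter_add_ncard_sdiff_eq_ncard y x, hcard, Set.inter_comm]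

end IsBasicScaling

theorem stmt_14 {S P : Type*} [Fintype S] [PartialOrder P] (ρ : Set S → P)
    (h : IsBasicScaling ρ) (hdiv : Divided ρ) :
    ∃ m : Set S → ℝ,
      (∀ T : Set S, T.Nonempty → 0 < m T) ∧
      (∀ T₁ T₂ : Set S, T₁ ∩ T₂ = ∅ → m (T₁ ∪ T₂) = m T₁ + m T₂) ∧
      (∀ T₁ T₂ : Set S, ρ T₁ = ρ T₂ → m T₁ = m T₂) ∧
      (∀ T₁ T₂ : Set S, ρ T₁ < ρ T₂ → m T₁ < m T₂) := by
  refine ⟨fun T => T.ncard, fun T hT => ?_, fun T₁ T₂ hT => ?_, fun T₁ T₂ hT => ?_,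
    fun T₁ T₂ hT => ?_⟩
  all_goals beta_reduce
  · exact_mod_cast (Set.ncard_pos).2 hT
  · exact_mod_cast Set.ncard_union_eq (Set.disjoint_iff_inter_eq_empty.2 hT)
  · exact_mod_cast h.ncard_eq hdiv hT
  · obtain ⟨T, hlt, hT⟩ := hdiv _ _ hT
    have hcard := Set.ncard_lt_ncard hlt
    rw [h.ncard_eq hdiv hT] at hcard
    exact_mod_cast hcard
end
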